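/- For every finite connected simple port-labeled graph G with n vertices, every root vertex v_R, and every integer k with 2 ≤ k ≤ n: suppose v is a non-rootpath vertex of V' and the k-stopped port-DFS traversal leaves v via its parent port par(v) with direction backward at move t. Then at every later move t' (up to and including the halting of the k-stopped traversal) at which the walk arrives at v, its direction is forward. -/

import Mathlib

open scoped Classical

/-- Direction of a move of the port-DFS traversal. -/
inductive PDir : Type where
  | fwd : PDir
  | bwd : PDir
deriving DecidableEq

/-- Position of the port-DFS walk: before the first move (`start`, at the root),
having just arrived at `cur` via in-port `inPort` with direction `dir` (`moving`),
or halted at a vertex. -/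
inductive PPos (V : Type) : Type where
  | start : PPos V
  | moving : V → ℕ → PDir → PPos V
  | halted : V → PPos V

/-- Full state of the port-DFS traversal: position, set `S` of visited vertices,
and parent-port assignment `par`. -/
structure PState (V : Type) : Type where
  pos : PPos V
  vis : Finset V
  par : V → ℕ

/-- A finite connected simple port-labeled graph: for every vertex `u` of degree
`deg u`, the edges incident to `u` are labeled by distinct ports `0, …, deg u - 1`;
`port u v` is the port at `u` of the edge `{u, v}`. -/
structure PortedGraph (V : Type) [Fintype V] [DecidableEq V] : Type where
  G : SimpleGraph V
  conn : G.Connected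
  deg : V → ℕ
  port : V → V → ℕ
  port_lt : ∀ {u v : V}, G.Adj u v → port u v < deg u
  port_inj : ∀ {u v w : V}, G.Adj u v → G.Adj u w → port u v = port u w → v = w
  port_surj : ∀ {u : V} (p : ℕ), p < deg u → ∃ v : V, G.Adj u v ∧ port u v = p

namespace PortedGraph

variable {V : Type} [Fintype V] [DecidableEq V]

/-- The neighbor of `u` reached from `u` through port `p`. -/
noncomputable def dest (P : PortedGraph V) (u : V) (p : ℕ) : V :=
  if h : ∃ v : V, P.G.Adj u v ∧ P.port u v = p then h.choose else u

/-- One step of the port-DFS traversal from root `vR`.  A state with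
`pos = moving v q d` means the walk has just arrived at `v` via port `q` (at `v`)
with direction `d`, and `vis`/`par` are the data from before processing this
arrival; the step processes the arrival according to rules (i)–(v) and performs
the next move (or halts). -/
noncomputable def step (P : PortedGraph V) (vR : V) (s : PState V) : PState V :=
  match s.pos with
  | PPos.start =>
      if 0 < P.deg vR then
        { pos := PPos.moving (P.dest vR 0) (P.port (P.dest vR 0) vR) PDir.fwd,
          vis := s.vis, par := s.par }
      else
        { pos := PPos.halted vR, vis := s.vis, par := s.par }
  | PPos.halted v => { pos := PPos.halted v, vis := s.vis, par := s.par }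
  | PPos.moving v q PDir.fwd =>
      if v ∈ s.vis then
        -- rule (ii): leave via `q` with direction backward
        { pos := PPos.moving (P.dest v q) (P.port (P.dest v q) v) PDir.bwd,
          vis := s.vis, par := s.par }
      else
        -- rule (i): add `v` to `S`, set `par v := q`, leave via `(q+1) % deg v`
        { pos := PPos.moving (P.dest v ((q + 1) % P.deg v))
            (P.port (P.dest v ((q + 1) % P.deg v)) v)
            (if (q + 1) % P.deg v = q then PDir.bwd else PDir.fwd),
          vis := insert v s.vis, par := Function.update s.par v q }
  | PPos.moving v q PDir.bwd =>
      if v ≠ vR ∧ (q + 1) % P.deg v = s.par v then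
        -- rule (iii): leave via the parent port with direction backward
        { pos := PPos.moving (P.dest v (s.par v)) (P.port (P.dest v (s.par v)) v) PDir.bwd,
          vis := s.vis, par := s.par }
      else if v = vR ∧ (q + 1) % P.deg v = 0 then
        -- rule (iv): halt
        { pos := PPos.halted v, vis := s.vis, par := s.par }
      else
        -- rule (v): leave via `(q+1) % deg v` with direction forward
        { pos := PPos.moving (P.dest v ((q + 1) % P.deg v))
            (P.port (P.dest v ((q + 1) % P.deg v)) v) PDir.fwd,
          vis := s.vis, par := s.par }

/-- The trace of the port-DFS traversal from `vR`:  `trace P vR t` is the state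
after `t` transitions; every transition except those into/out of a halted
position is a move along an edge. -/
noncomputable def trace (P : PortedGraph V) (vR : V) : ℕ → PState V
  | 0 => { pos := PPos.start, vis := {vR}, par := fun _ => 0 }
  | t + 1 => P.step vR (P.trace vR t)

/-- The first time at which `k` distinct vertices have been visited; the
`k`-stopped traversal is the traversal halted at that moment (at which point the
walk, having made `stopTime - 1` moves, stands at the `k`-th visited vertex). -/
noncomputable def stopTime (P : PortedGraph V) (vR : V) (k : ℕ) : ℕ :=
  sInf {t : ℕ | k ≤ ((P.trace vR t).vis).card}

/-- `V'`: the set of vertices visited by the `k`-stopped traversal. -/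
noncomputable def visitedBy (P : PortedGraph V) (vR : V) (k : ℕ) : Finset V :=
  (P.trace vR (P.stopTime vR k)).vis

/-- `V'` as a set. -/
noncomputable def Vset (P : PortedGraph V) (vR : V) (k : ℕ) : Set V :=
  ↑(P.visitedBy vR k)

/-- The parent-port assignment at the end of the `k`-stopped traversal. -/
noncomputable def parFinal (P : PortedGraph V) (vR : V) (k : ℕ) : V → ℕ :=
  (P.trace vR (P.stopTime vR k)).par

/-- `u(v)`: the neighbor of `v` reached from `v` through its parent port. -/
noncomputable def parentVert (P : PortedGraph V) (vR : V) (k : ℕ) (v : V) : V :=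
  P.dest v (P.parFinal vR k v)

/-- `v_L`: the `k`-th (last) vertex added to `S` by the `k`-stopped traversal. -/
noncomputable def lastVert (P : PortedGraph V) (vR : V) (k : ℕ) : V :=
  if h : ∃ v : V, v ∈ P.visitedBy vR k ∧ v ∉ (P.trace vR (P.stopTime vR k - 1)).vis
  then h.choose else vR

/-- The tree `T` of parent edges `{v, u(v)}`, `v ∈ V' \ {v_R}`, as a graph on `V`
(vertices outside `V'` are isolated). -/
noncomputable def treeRel (P : PortedGraph V) (vR : V) (k : ℕ) : SimpleGraph V :=
  SimpleGraph.fromRel (fun a b =>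
    a ∈ P.visitedBy vR k ∧ a ≠ vR ∧ b = P.parentVert vR k a)

/-- The tree `T` of parent edges as a graph on the vertex set `V'`. -/
noncomputable def treeSub (P : PortedGraph V) (vR : V) (k : ℕ) :
    SimpleGraph (P.Vset vR k) :=
  SimpleGraph.fromRel (fun a b => (a : V) ≠ vR ∧ (b : V) = P.parentVert vR k (a : V))

/-- `v` lies on the rootpath: the unique path in `T` from `v_R` to `v_L`. -/
def onRootpath (P : PortedGraph V) (vR : V) (k : ℕ) (v : V) : Prop :=
  ∃ p : (P.treeRel vR k).Walk vR (P.lastVert vR k), p.IsPath ∧ v ∈ p.support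

/-- The move made out of state `s`:  `some (v, p, d)` if the walk leaves vertex
`v` via port `p` with direction `d`, and `none` if it halts (or already halted). -/
noncomputable def exitEvent (P : PortedGraph V) (vR : V) (s : PState V) :
    Option (V × ℕ × PDir) :=
  match s.pos with
  | PPos.start => if 0 < P.deg vR then some (vR, 0, PDir.fwd) else none
  | PPos.halted _ => none
  | PPos.moving v q PDir.fwd =>
      if v ∈ s.vis then some (v, q, PDir.bwd)
      else some (v, (q + 1) % P.deg v,
        if (q + 1) % P.deg v = q then PDir.bwd else PDir.fwd)
  | PPos.moving v q PDir.bwd =>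
      if v ≠ vR ∧ (q + 1) % P.deg v = s.par v then some (v, s.par v, PDir.bwd)
      else if v = vR ∧ (q + 1) % P.deg v = 0 then none
      else some (v, (q + 1) % P.deg v, PDir.fwd)

end PortedGraph

namespace PortedGraph

/-- `IsOpenStack vR f L`: the list `L` is duplicate-free, ends in `vR`, and `f` sends every
entry other than the last to the entry following it. -/
inductive IsOpenStack {V : Type} (vR : V) (f : V → V) : List V → Prop where
  | root : IsOpenStack vR f [vR]
  | push {a b : V} {l : List V} : IsOpenStack vR f (b :: l) → a ∉ b :: l → f a = b →
      IsOpenStack vR f (a :: b :: l)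

namespace IsOpenStack

variable {V : Type} {vR : V} {f g : V → V} {L l : List V} {a v : V}

theorem congr (h : IsOpenStack vR f L) (hfg : ∀ a ∈ L, f a = g a) : IsOpenStack vR g L := by
  induction h with
  | root => exact .root
  | @push a b l _ hn hf ih =>
    exact .push (ih fun x hx => hfg x (List.mem_cons_of_mem _ hx)) hn
      ((hfg a List.mem_cons_self).symm.trans hf)

theorem head_notMem (h : IsOpenStack vR f (a :: l)) : a ∉ l := by
  cases h with
  | root => simp
  | push _ hn _ => exact hn

theorem apply_mem_tail (h : IsOpenStack vR f L) (hv : v ∈ L) (hne : v ≠ vR) :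
    f v ∈ L.tail := by
  induction h with
  | root => simp_all
  | @push a b l _ _ hf ih =>
    rcases List.mem_cons.1 hv with rfl | hv
    · simp [hf]
    · exact List.mem_cons_of_mem _ (ih hv)

end IsOpenStack

variable {V : Type} [Fintype V] [DecidableEq V]

theorem adj_dest (P : PortedGraph V) {u : V} {p : ℕ} (hp : p < P.deg u) :
    P.G.Adj u (P.dest u p) ∧ P.port u (P.dest u p) = p := by
  have h := P.port_surj p hp
  rw [dest, dif_pos h]
  exact h.choose_spec

theorem dest_port (P : PortedGraph V) {u v : V} (h : P.G.Adj u v) :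
    P.dest u (P.port u v) = v := by
  obtain ⟨h₁, h₂⟩ := P.adj_dest (P.port_lt h)
  exact P.port_inj h₁ h h₂

/-- The position of the state `s` is consistent with the stack `L` of open vertices: a forward
move comes from the top of the stack and does not use its parent port, and a backward move leads
to the top of the stack. -/
def PosFits (P : PortedGraph V) (vR : V) (s : PState V) (L : List V) : Prop :=
  match s.pos with
  | PPos.start => L = [vR]
  | PPos.halted _ => True
  | PPos.moving v q PDir.fwd => ∃ u l, L = u :: l ∧ P.G.Adj v u ∧ q = P.port v u ∧
      (u ≠ vR → P.port u v ≠ s.par u)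
  | PPos.moving v _ PDir.bwd => (∃ l, L = v :: l) ∧ 0 < P.deg v

/-- `L` is the stack of open (visited but not yet left for good) vertices in the state `s`. -/
structure OpenAt (P : PortedGraph V) (vR : V) (s : PState V) (L : List V) : Prop where
  stack : IsOpenStack vR (fun a => P.dest a (s.par a)) L
  mem_vis : ∀ a ∈ L, a ∈ s.vis
  fits : P.PosFits vR s L

/-- One step of the traversal keeps a stack of open vertices, opening only unvisited vertices and
closing a vertex that is left backward via its parent port. -/
theorem OpenAt.step {P : PortedGraph V} {vR : V} {s : PState V} {L : List V}
    (h : P.OpenAt vR s L) : ∃ L', P.OpenAt vR (P.step vR s) L' ∧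
      (∀ a ∈ L', a ∈ L ∨ a ∉ s.vis) ∧
      (∀ v p, P.exitEvent vR s = some (v, p, PDir.bwd) →
        (s.pos = PPos.moving v p PDir.fwd ∧ v ∈ s.vis) ∨
          (v ∉ L' ∧ v ∈ (P.step vR s).vis)) := by
  obtain ⟨pos, vis, par⟩ := s
  obtain ⟨hs, hm, hf⟩ := h
  match pos with
  | PPos.halted v =>
    exact ⟨L, ⟨hs, hm, trivial⟩, fun a ha => .inl ha, by simp [exitEvent]⟩
  | PPos.start =>
    simp only [PosFits] at hf
    subst hf
    refine ⟨[vR], ?_, fun a ha => .inl ha, by simp [exitEvent]⟩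
    by_cases hd : 0 < P.deg vR
    · simp only [PortedGraph.step, if_pos hd]
      exact ⟨hs, hm, vR, [], rfl, (P.adj_dest hd).1.symm, rfl, fun h => (h rfl).elim⟩
    · simp only [PortedGraph.step, if_neg hd]
      exact ⟨hs, hm, trivial⟩
  | PPos.moving v q PDir.fwd =>
    obtain ⟨u, l, rfl, hadj, rfl, hpar⟩ := hf
    by_cases hv : v ∈ vis
    · refine ⟨u :: l, ?_, fun a ha => .inl ha, ?_⟩
      · simp only [PortedGraph.step, if_pos hv, P.dest_port hadj]
        exact ⟨hs, hm, ⟨l, rfl⟩, (Nat.zero_le _).trans_lt (P.port_lt hadj.symm)⟩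
      · intro w p hw
        simp only [exitEvent, if_pos hv, Option.some.injEq, Prod.mk.injEq] at hw
        obtain ⟨rfl, rfl, -⟩ := hw
        exact .inl ⟨rfl, hv⟩
    · have hvL : v ∉ u :: l := fun h => hv (hm v h)
      have hs' : IsOpenStack vR
          (fun a => P.dest a (Function.update par v (P.port v u) a)) (u :: l) :=
        hs.congr fun a ha => by
          have : a ≠ v := fun h => hvL (h ▸ ha)
          simp [this]
      have hd : 0 < P.deg v := (Nat.zero_le _).trans_lt (P.port_lt hadj)
      by_cases hq : (P.port v u + 1) % P.deg v = P.port v u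
      · refine ⟨u :: l, ?_, fun a ha => .inl ha, ?_⟩
        · simp only [PortedGraph.step, if_neg hv, if_pos hq]
          rw [hq, P.dest_port hadj]
          exact ⟨hs', fun a ha => Finset.mem_insert_of_mem (hm a ha), ⟨l, rfl⟩,
            (Nat.zero_le _).trans_lt (P.port_lt hadj.symm)⟩
        · intro w p hw
          simp only [exitEvent, if_neg hv, if_pos hq, Option.some.injEq, Prod.mk.injEq] at hw
          obtain ⟨rfl, -⟩ := hw
          exact .inr ⟨hvL, by simp [PortedGraph.step, hv]⟩
      · obtain ⟨h₁, h₂⟩ := P.adj_dest (Nat.mod_lt (P.port v u + 1) hd)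
        refine ⟨v :: u :: l, ?_, ?_, ?_⟩
        · simp only [PortedGraph.step, if_neg hv, if_neg hq]
          refine ⟨hs'.push hvL (by simp [P.dest_port hadj]), ?_, v, u :: l, rfl, h₁.symm, rfl, ?_⟩
          · intro a ha
            rcases List.mem_cons.1 ha with rfl | ha
            · exact Finset.mem_insert_self _ _
            · exact Finset.mem_insert_of_mem (hm a ha)
          · intro _
            simpa [h₂] using hq
        · intro a ha
          rcases List.mem_cons.1 ha with rfl | ha
          · exact .inr hv
          · exact .inl ha
        · intro w p hw
          simp [exitEvent, hv, hq] at hw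
  | PPos.moving v q PDir.bwd =>
    obtain ⟨⟨l, rfl⟩, hd⟩ := hf
    by_cases h₁ : v ≠ vR ∧ (q + 1) % P.deg v = par v
    · cases hs with
      | root => exact (h₁.1 rfl).elim
      | @push _ b l hs hn hb =>
        simp only at hb
        have hlt := Nat.mod_lt (q + 1) hd
        rw [h₁.2] at hlt
        have hadj := (P.adj_dest hlt).1
        rw [hb] at hadj
        refine ⟨b :: l, ?_, fun a ha => .inl (List.mem_cons_of_mem _ ha), ?_⟩
        · simp only [PortedGraph.step, if_pos h₁, hb]
          exact ⟨hs, fun a ha => hm a (List.mem_cons_of_mem _ ha), ⟨l, rfl⟩,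
            (Nat.zero_le _).trans_lt (P.port_lt hadj.symm)⟩
        · intro w p hw
          simp only [exitEvent, if_pos h₁, Option.some.injEq, Prod.mk.injEq] at hw
          obtain ⟨rfl, -⟩ := hw
          refine .inr ⟨hn, ?_⟩
          simp only [PortedGraph.step, if_pos h₁]
          exact hm _ List.mem_cons_self
    · refine ⟨v :: l, ?_, fun a ha => .inl ha, ?_⟩
      · by_cases h₂ : v = vR ∧ (q + 1) % P.deg v = 0
        · simp only [PortedGraph.step, if_neg h₁, if_pos h₂]
          exact ⟨hs, hm, trivial⟩
        · simp only [PortedGraph.step, if_neg h₁, if_neg h₂]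
          obtain ⟨h₃, h₄⟩ := P.adj_dest (Nat.mod_lt (q + 1) hd)
          refine ⟨hs, hm, v, l, rfl, h₃.symm, rfl, fun hne => ?_⟩
          rw [h₄]
          exact fun h => h₁ ⟨hne, h⟩
      · intro w p hw
        simp only [exitEvent, if_neg h₁] at hw
        split_ifs at hw
        simp at hw

theorem exists_openAt_trace (P : PortedGraph V) (vR : V) (t : ℕ) :
    ∃ L, P.OpenAt vR (P.trace vR t) L := by
  induction t with
  | zero => exact ⟨[vR], .root, by simp [trace], rfl⟩
  | succ t ih =>
    obtain ⟨L, hL⟩ := ih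
    obtain ⟨L', hL', -⟩ := hL.step
    exact ⟨L', hL'⟩

/-- Visited vertices stay visited and keep their parent port. -/
theorem step_persist (P : PortedGraph V) (vR : V) {s : PState V} {v : V} (hv : v ∈ s.vis) :
    v ∈ (P.step vR s).vis ∧ (P.step vR s).par v = s.par v := by
  obtain ⟨pos, vis, par⟩ := s
  simp only at hv
  unfold step
  split
  · split_ifs <;> exact ⟨hv, rfl⟩
  · exact ⟨hv, rfl⟩
  · rename_i w q _
    split_ifs with hw
    · exact ⟨hv, rfl⟩
    all_goals
      have : v ≠ w := fun h => hw (h ▸ hv)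
      exact ⟨Finset.mem_insert_of_mem hv, by simp [this]⟩
  · split_ifs <;> exact ⟨hv, rfl⟩

theorem trace_persist (P : PortedGraph V) (vR : V) {v : V} {t t' : ℕ} (h : t ≤ t')
    (hv : v ∈ (P.trace vR t).vis) :
    v ∈ (P.trace vR t').vis ∧ (P.trace vR t').par v = (P.trace vR t).par v := by
  induction t', h using Nat.le_induction with
  | base => exact ⟨hv, rfl⟩
  | succ n _ ih =>
    obtain ⟨h₁, h₂⟩ := P.step_persist vR ih.1
    exact ⟨h₁, h₂.trans ih.2⟩

/-- The neighbor of the root behind port `0` is the first one explored, hence gets the root as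
its parent. -/
theorem par_dest_root (P : PortedGraph V) (vR : V) (hd : 0 < P.deg vR) (t : ℕ) :
    P.dest vR 0 ∈ (P.trace vR (t + 2)).vis ∧
      (P.trace vR (t + 2)).par (P.dest vR 0) = P.port (P.dest vR 0) vR := by
  have hne : P.dest vR 0 ≠ vR := (P.adj_dest hd).1.ne'
  have h₂ : P.dest vR 0 ∈ (P.trace vR 2).vis ∧
      (P.trace vR 2).par (P.dest vR 0) = P.port (P.dest vR 0) vR := by
    simp [trace, step, hd, hne]
  obtain ⟨h₃, h₄⟩ := P.trace_persist vR (Nat.le_add_left 2 t) h₂.1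
  exact ⟨h₃, h₄.trans h₂.2⟩

/-- The root is never entered forward via port `0`. -/
theorem root_not_entered_zero (P : PortedGraph V) (vR : V) (t : ℕ) :
    (P.trace vR t).pos ≠ PPos.moving vR 0 PDir.fwd := by
  intro hpos
  obtain ⟨L, hL⟩ := P.exists_openAt_trace vR t
  have hf := hL.fits
  simp only [PosFits, hpos] at hf
  obtain ⟨u, l, -, hadj, hq, hpar⟩ := hf
  have hd : 0 < P.deg vR := (Nat.zero_le _).trans_lt (P.port_lt hadj)
  have hu : P.dest vR 0 = u := by rw [hq, P.dest_port hadj]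
  match t with
  | 0 => simp [trace] at hpos
  | 1 =>
    simp only [trace, step, if_pos hd, PPos.moving.injEq] at hpos
    exact hadj.ne (hpos.1.symm.trans hu)
  | t + 2 =>
    have := (P.par_dest_root vR hd t).2
    rw [hu] at this
    exact hpar hadj.ne' this.symm

/-- An open vertex is never entered forward via its parent port. -/
theorem OpenAt.notMem_of_entered_par {P : PortedGraph V} {vR : V} {s : PState V} {L : List V}
    (h : P.OpenAt vR s L) {v : V} (hne : v ≠ vR)
    (hpos : s.pos = PPos.moving v (s.par v) PDir.fwd) : v ∉ L := by
  intro hv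
  have hf := h.fits
  simp only [PosFits, hpos] at hf
  obtain ⟨u, l, rfl, hadj, hq, -⟩ := hf
  have := h.stack.apply_mem_tail hv hne
  simp only [hq, P.dest_port hadj, List.tail_cons] at this
  exact h.stack.head_notMem this

/-- A visited vertex that is no longer open is never opened again. -/
theorem closed_trace (P : PortedGraph V) (vR : V) {v : V} {t t' : ℕ} (h : t ≤ t')
    (hc : v ∈ (P.trace vR t).vis ∧ ∃ L, P.OpenAt vR (P.trace vR t) L ∧ v ∉ L) :
    v ∈ (P.trace vR t').vis ∧ ∃ L, P.OpenAt vR (P.trace vR t') L ∧ v ∉ L := by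
  induction t', h using Nat.le_induction with
  | base => exact hc
  | succ n _ ih =>
    obtain ⟨hv, L, hL, hvL⟩ := ih
    obtain ⟨L', hL', hsub, -⟩ := hL.step
    exact ⟨(P.step_persist vR hv).1, L', hL', fun h => (hsub v h).elim hvL (· hv)⟩

end PortedGraph

/-- for every `2 ≤ k ≤ n`, if `v` is a non-rootpath vertex of `V'`
and the `k`-stopped port-DFS traversal leaves `v` via its parent port `par(v)`
with direction backward at move `t` (moves being indexed `1, …, stopTime - 1`),
then at every later move `t'` of the `k`-stopped traversal at which the walk
arrives at `v`, its direction is forward. -/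
theorem statement7 {V : Type} [Fintype V] [DecidableEq V]
    (P : PortedGraph V) (vR : V) (k : ℕ)
    (hk1 : 2 ≤ k) (hk2 : k ≤ Fintype.card V)
    (v : V) (hv : v ∈ P.visitedBy vR k) (hnr : ¬ P.onRootpath vR k v)
    (t : ℕ) (ht1 : 1 ≤ t) (ht2 : t ≤ P.stopTime vR k - 1)
    (hleave : P.exitEvent vR (P.trace vR (t - 1))
      = some (v, P.parFinal vR k v, PDir.bwd)) :
    ∀ t' : ℕ, t < t' → t' ≤ P.stopTime vR k - 1 →
      ∀ (q : ℕ) (d : PDir), (P.trace vR t').pos = PPos.moving v q d →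
        d = PDir.fwd := by
  intro t' htt' _ q d hpos
  obtain ⟨n, rfl⟩ : ∃ n, t = n + 1 := ⟨t - 1, by omega⟩
  rw [Nat.add_sub_cancel] at hleave
  obtain ⟨L, hL⟩ := P.exists_openAt_trace vR n
  obtain ⟨L', hL', hsub, hexit⟩ := hL.step
  have hclosed : v ∉ L' ∧ v ∈ (P.trace vR (n + 1)).vis := by
    rcases hexit v _ hleave with ⟨hp, hvis⟩ | h
    · have hfin : P.parFinal vR k v = (P.trace vR n).par v :=
        (P.trace_persist vR (by omega) hvis).2
      rw [hfin] at hp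
      have hne : v ≠ vR := by
        rintro rfl
        have h₀ : (P.trace v n).par v = 0 :=
          (P.trace_persist v (Nat.zero_le n) (by simp [PortedGraph.trace])).2
        rw [h₀] at hp
        exact P.root_not_entered_zero v n hp
      exact ⟨fun h => (hsub v h).elim (hL.notMem_of_entered_par hne hp) (· hvis),
        (P.step_persist vR hvis).1⟩
    · exact h
  obtain ⟨-, M, hM, hvM⟩ := P.closed_trace vR htt'.le ⟨hclosed.2, L', hL', hclosed.1⟩
  cases d with
  | fwd => rfl
  | bwd =>
    have hf := hM.fits
    simp only [PortedGraph.PosFits, hpos] at hf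
    obtain ⟨⟨l, rfl⟩, -⟩ := hf
    exact (hvM List.mem_cons_self).elim
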